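/- The Steane error-correcting circuit corrects any error consisting of at most one bit-flip and at most one phase-flip (not necessarily on the same qubit): for every ψ in the codespace C and every error E ∈ {1} ∪ {X i : i ∈ Fin 7} ∪ {Z k : k ∈ Fin 7} ∪ {X i ∘ Z k : i, k ∈ Fin 7}, the recovery operator T satisfies T (E ψ) = ψ. -/

import Mathlib

noncomputable section

abbrev V7 := Fin 7 → ZMod 2
abbrev H7 := V7 → ℂ

/-- The three Steane-code supports. -/
def S : Fin 3 → Finset (Fin 7)
  | 0 => {0, 4, 5, 6}
  | 1 => {1, 3, 5, 6}
  | 2 => {2, 3, 4, 6}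

/-- Pauli X on qubit `i`: `X i (e_v) = e_{v'}` with `v' = v` except `v' i = v i + 1`. -/
def Xop (i : Fin 7) : H7 →ₗ[ℂ] H7 where
  toFun ψ := fun v => ψ (v + Pi.single i 1)
  map_add' _ _ := rfl
  map_smul' _ _ := by funext v; simp

/-- Pauli Z on qubit `i`: `Z i (e_v) = (-1)^(v i) e_v`. -/
def Zop (i : Fin 7) : H7 →ₗ[ℂ] H7 where
  toFun ψ := fun v => (-1 : ℂ) ^ (v i).val * ψ v
  map_add' ψ φ := by funext v; simp [mul_add]
  map_smul' c ψ := by funext v; simp; ring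

/-- Stabilizer generator `gX j = ∏_{i ∈ S j} X i` (the factors commute). -/
def gX (j : Fin 3) : H7 →ₗ[ℂ] H7 :=
  (S j).noncommProd (fun i => Xop i) (fun a _ b _ _ => by
    apply LinearMap.ext; intro ψ; funext v
    exact congrArg ψ (add_right_comm v (Pi.single a 1) (Pi.single b 1)))

/-- Stabilizer generator `gZ j = ∏_{i ∈ S j} Z i` (the factors commute). -/
def gZ (j : Fin 3) : H7 →ₗ[ℂ] H7 :=
  (S j).noncommProd (fun i => Zop i) (fun a _ b _ _ => by
    apply LinearMap.ext; intro ψ; funext v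
    show (-1:ℂ) ^ (v a).val * ((-1:ℂ) ^ (v b).val * ψ v)
       = (-1:ℂ) ^ (v b).val * ((-1:ℂ) ^ (v a).val * ψ v)
    ring)

/-- Indicator vector of `S j`. -/
def r (j : Fin 3) : V7 := fun i => if i ∈ S j then 1 else 0

/-- The 𝔽₂-span of the three rows. -/
def Hcode : Submodule (ZMod 2) V7 := Submodule.span (ZMod 2) {r 0, r 1, r 2}

/-- Standard basis vector `e_v`. -/
def e (v : V7) : H7 := Pi.single v 1

/-- Logical codeword `u₀ = 8^{-1/2} ∑_{v ∈ H} e_v`. -/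
def u0 : H7 := ((Real.sqrt 8 : ℂ))⁻¹ • ∑ᶠ v ∈ (Hcode : Set V7), e v

/-- Logical codeword `u₁ = 8^{-1/2} ∑_{v ∈ H} e_{v + 𝟙}`. -/
def u1 : H7 := ((Real.sqrt 8 : ℂ))⁻¹ • ∑ᶠ v ∈ (Hcode : Set V7), e (v + 1)

/-- The codespace `C = Span_ℂ {u₀, u₁}`. -/
def Cspace : Submodule ℂ H7 := Submodule.span ℂ {u0, u1}


/-- The syndrome map: `σ i j = 1` if `i ∈ S j`, else `0`. -/
def σs (i : Fin 7) : Fin 3 → ZMod 2 := fun j => if i ∈ S j then 1 else 0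

/-- `loc` is the inverse of the syndrome map (on nonzero syndromes). -/
def loc : (Fin 3 → ZMod 2) → Fin 7 := Function.invFun σs

/-- Projector factor `(1 + (-1)^s gZ j) / 2`. -/
def PZ (s : ZMod 2) (j : Fin 3) : H7 →ₗ[ℂ] H7 :=
  (2 : ℂ)⁻¹ • (1 + ((-1 : ℂ) ^ s.val) • gZ j)

/-- Projector factor `(1 + (-1)^s gX j) / 2`. -/
def PX (s : ZMod 2) (j : Fin 3) : H7 →ₗ[ℂ] H7 :=
  (2 : ℂ)⁻¹ • (1 + ((-1 : ℂ) ^ s.val) • gX j)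

/-- The syndrome projector
`Π(u,w) = ∏_j (1 + (-1)^(u j) gZ j)/2 ∘ ∏_j (1 + (-1)^(w j) gX j)/2`. -/
def Proj (u w : Fin 3 → ZMod 2) : H7 →ₗ[ℂ] H7 :=
  (PZ (u 0) 0 * PZ (u 1) 1 * PZ (u 2) 2) * (PX (w 0) 0 * PX (w 1) 1 * PX (w 2) 2)

/-- The correction applied on syndrome `(u, w)`. -/
def R (u w : Fin 3 → ZMod 2) : H7 →ₗ[ℂ] H7 :=
  (if w ≠ 0 then Zop (loc w) else 1) * (if u ≠ 0 then Xop (loc u) else 1)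

/-- The recovery operator `T = Σ_{(u,w)} R(u,w) ∘ Π(u,w)`. -/
def T : H7 →ₗ[ℂ] H7 :=
  ∑ p : (Fin 3 → ZMod 2) × (Fin 3 → ZMod 2), R p.1 p.2 * Proj p.1 p.2

/-- Errors consisting of at most one bit flip and at most one phase flip. -/
def errSet : Set (H7 →ₗ[ℂ] H7) :=
  {1} ∪ (Set.range Xop) ∪ (Set.range Zop) ∪ {f | ∃ i k, f = Xop i * Zop k}

lemma sgn_add (a b : ZMod 2) : (-1 : ℂ) ^ (a + b).val = (-1 : ℂ) ^ a.val * (-1 : ℂ) ^ b.val := by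
  rw [← pow_add, ZMod.val_add, ← neg_one_pow_eq_pow_mod_two]

lemma sgn_sq (a : ZMod 2) : (-1 : ℂ) ^ a.val * (-1 : ℂ) ^ a.val = 1 := by
  rw [← pow_add, ← two_mul, pow_mul]; simp

lemma dbl (v : V7) : v + v = 0 := CharTwo.add_self_eq_zero v

lemma Xop_apply (i : Fin 7) (φ : H7) (v : V7) : Xop i φ v = φ (v + Pi.single i 1) := rfl

lemma Zop_apply (i : Fin 7) (φ : H7) (v : V7) : Zop i φ v = (-1 : ℂ) ^ (v i).val * φ v := rfl

lemma noncommX (s : Finset (Fin 7)) (h) (φ : H7) (v : V7) :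
    (s.noncommProd (fun i => Xop i) h) φ v = φ (v + ∑ i ∈ s, Pi.single i 1) := by
  induction s using Finset.induction_on generalizing φ v with
  | empty => simp
  | insert a s ha ih =>
    rw [Finset.noncommProd_insert_of_notMem _ _ _ _ ha, Module.End.mul_apply, Xop_apply, ih,
      Finset.sum_insert ha, add_assoc]

lemma noncommZ (s : Finset (Fin 7)) (h) (φ : H7) (v : V7) :
    (s.noncommProd (fun i => Zop i) h) φ v = (-1 : ℂ) ^ (∑ i ∈ s, v i).val * φ v := by
  induction s using Finset.induction_on generalizing φ v with
  | empty => simp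
  | insert a s ha ih =>
    rw [Finset.noncommProd_insert_of_notMem _ _ _ _ ha, Module.End.mul_apply, Zop_apply, ih,
      Finset.sum_insert ha, sgn_add, mul_assoc]

lemma sum_single (j : Fin 3) : ∑ i ∈ S j, (Pi.single i 1 : V7) = r j := by
  revert j; decide

lemma gX_apply (j : Fin 3) (φ : H7) (v : V7) : gX j φ v = φ (v + r j) := by
  rw [← sum_single]; exact noncommX (S j) _ φ v

lemma gZ_apply (j : Fin 3) (φ : H7) (v : V7) :
    gZ j φ v = (-1 : ℂ) ^ (∑ i ∈ S j, v i).val * φ v := by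
  exact noncommZ (S j) _ φ v

lemma sigma_inj : Function.Injective σs := by
  intro a b; revert a b; decide

lemma loc_sigma (i : Fin 7) : loc (σs i) = i := Function.leftInverse_invFun sigma_inj i

lemma sigma_ne (i : Fin 7) : σs i ≠ 0 := by revert i; decide

lemma sigma_surj : ∀ u : Fin 3 → ZMod 2, u ≠ 0 → ∃ i, σs i = u := by decide

lemma sigma_loc (u : Fin 3 → ZMod 2) (hu : u ≠ 0) : σs (loc u) = u :=
  Function.invFun_eq (sigma_surj u hu)

/-- X part of a correction. -/
def xo (u : Fin 3 → ZMod 2) : H7 →ₗ[ℂ] H7 := if u ≠ 0 then Xop (loc u) else 1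

/-- Z part of a correction. -/
def zo (w : Fin 3 → ZMod 2) : H7 →ₗ[ℂ] H7 := if w ≠ 0 then Zop (loc w) else 1

lemma xo_zero : xo 0 = 1 := by simp [xo]
lemma zo_zero : zo 0 = 1 := by simp [zo]
lemma xo_sigma (i : Fin 7) : xo (σs i) = Xop i := by simp [xo, sigma_ne, loc_sigma]
lemma zo_sigma (i : Fin 7) : zo (σs i) = Zop i := by simp [zo, sigma_ne, loc_sigma]

lemma cases_syn (u : Fin 3 → ZMod 2) : u = 0 ∨ ∃ i, u = σs i := by
  by_cases h : u = 0
  · exact Or.inl h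
  · exact Or.inr ⟨loc u, (sigma_loc u h).symm⟩

lemma xo_xo (u) (φ : H7) : xo u (xo u φ) = φ := by
  rcases cases_syn u with rfl | ⟨i, rfl⟩
  · simp [xo_zero]
  · rw [xo_sigma]; funext v
    rw [Xop_apply, Xop_apply, add_assoc, dbl, add_zero]

lemma zo_zo (u) (φ : H7) : zo u (zo u φ) = φ := by
  rcases cases_syn u with rfl | ⟨i, rfl⟩
  · simp [zo_zero]
  · rw [zo_sigma]; funext v
    rw [Zop_apply, Zop_apply, ← mul_assoc, sgn_sq, one_mul]

lemma gX_xo (j u) (φ : H7) : gX j (xo u φ) = xo u (gX j φ) := by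
  rcases cases_syn u with rfl | ⟨i, rfl⟩
  · simp [xo_zero]
  · rw [xo_sigma]; funext v
    rw [Xop_apply, gX_apply, gX_apply, Xop_apply, add_right_comm]

lemma gZ_zo (j u) (φ : H7) : gZ j (zo u φ) = zo u (gZ j φ) := by
  rcases cases_syn u with rfl | ⟨i, rfl⟩
  · simp [zo_zero]
  · rw [zo_sigma]; funext v
    rw [Zop_apply, gZ_apply, gZ_apply, Zop_apply, mul_left_comm]

lemma gX_zo (j u) (φ : H7) : gX j (zo u φ) = (-1 : ℂ) ^ (u j).val • zo u (gX j φ) := by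
  rcases cases_syn u with rfl | ⟨i, rfl⟩
  · simp [zo_zero]
  · rw [zo_sigma]; funext v
    have h : r j i = σs i j := rfl
    rw [Pi.smul_apply, smul_eq_mul, Zop_apply, gX_apply, gX_apply, Zop_apply, Pi.add_apply,
      sgn_add, h]
    ring

lemma sum_single_apply (j : Fin 3) (i : Fin 7) :
    ∑ k ∈ S j, (Pi.single i 1 : V7) k = σs i j := by
  revert j i; decide

lemma gZ_xo (j u) (φ : H7) : gZ j (xo u φ) = (-1 : ℂ) ^ (u j).val • xo u (gZ j φ) := by
  rcases cases_syn u with rfl | ⟨i, rfl⟩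
  · simp [xo_zero]
  · rw [xo_sigma]; funext v
    simp only [Pi.smul_apply, smul_eq_mul, Xop_apply, gZ_apply, Pi.add_apply,
      Finset.sum_add_distrib, sum_single_apply, sgn_add]
    linear_combination (-(-1 : ℂ) ^ (∑ k ∈ S j, v k).val * φ (v + Pi.single i 1)) *
      sgn_sq (σs i j)

lemma sgn_proj (s t : ZMod 2) :
    (2 : ℂ)⁻¹ * (1 + (-1 : ℂ) ^ s.val * (-1 : ℂ) ^ t.val) = if s = t then 1 else 0 := by
  rw [← sgn_add]
  have : ∀ s t : ZMod 2, (s = t ∧ (s + t).val = 0) ∨ (s ≠ t ∧ (s + t).val = 1) := by decide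
  rcases this s t with ⟨h, h'⟩ | ⟨h, h'⟩
  · rw [h', if_pos h]; norm_num
  · rw [h', if_neg h]; norm_num

lemma PX_eig (s t : ZMod 2) (j) (φ : H7) (h : gX j φ = (-1 : ℂ) ^ t.val • φ) :
    PX s j φ = (if s = t then (1 : ℂ) else 0) • φ := by
  rw [← sgn_proj, PX, LinearMap.smul_apply, LinearMap.add_apply, LinearMap.smul_apply, h,
    Module.End.one_apply]
  module

lemma PZ_eig (s t : ZMod 2) (j) (φ : H7) (h : gZ j φ = (-1 : ℂ) ^ t.val • φ) :
    PZ s j φ = (if s = t then (1 : ℂ) else 0) • φ := by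
  rw [← sgn_proj, PZ, LinearMap.smul_apply, LinearMap.add_apply, LinearMap.smul_apply, h,
    Module.End.one_apply]
  module

lemma Proj_eig (u w u' w' : Fin 3 → ZMod 2) (φ : H7)
    (hX : ∀ j, gX j φ = (-1 : ℂ) ^ (w' j).val • φ)
    (hZ : ∀ j, gZ j φ = (-1 : ℂ) ^ (u' j).val • φ) :
    Proj u w φ = if (u, w) = (u', w') then φ else 0 := by
  simp only [Proj, Module.End.mul_apply, map_smul, PX_eig _ _ _ _ (hX _), PZ_eig _ _ _ _ (hZ _)]
  by_cases h : (u, w) = (u', w')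
  · obtain ⟨rfl, rfl⟩ := Prod.mk.inj h
    simp
  · rw [if_neg h]
    have : ¬ ((u 0 = u' 0 ∧ u 1 = u' 1 ∧ u 2 = u' 2) ∧ (w 0 = w' 0 ∧ w 1 = w' 1 ∧ w 2 = w' 2)) := by
      rintro ⟨⟨a, b, c⟩, d, e, f⟩
      apply h
      congr 1
      · funext j; fin_cases j <;> assumption
      · funext j; fin_cases j <;> assumption
    simp only [smul_smul]
    convert zero_smul ℂ φ
    split_ifs <;> simp_all

lemma T_corr (u w : Fin 3 → ZMod 2) (ψ : H7) (hX : ∀ j, gX j ψ = ψ) (hZ : ∀ j, gZ j ψ = ψ) :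
    T (xo u (zo w ψ)) = ψ := by
  have h1 : ∀ j, gX j (xo u (zo w ψ)) = (-1 : ℂ) ^ (w j).val • xo u (zo w ψ) := by
    intro j; rw [gX_xo, gX_zo, hX, map_smul]
  have h2 : ∀ j, gZ j (xo u (zo w ψ)) = (-1 : ℂ) ^ (u j).val • xo u (zo w ψ) := by
    intro j; rw [gZ_xo, gZ_zo, hZ]
  rw [T, LinearMap.sum_apply, Finset.sum_eq_single (u, w)]
  · rw [Module.End.mul_apply, Proj_eig _ _ u w _ h1 h2, if_pos rfl]
    change (zo w * xo u) _ = _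
    rw [Module.End.mul_apply, xo_xo, zo_zo]
  · rintro ⟨a, b⟩ _ hab
    rw [Module.End.mul_apply, Proj_eig _ _ u w _ h1 h2, if_neg hab, map_zero]
  · simp

lemma T_corr2 (u w : Fin 3 → ZMod 2) (ψ : H7) (hX : ∀ j, gX j ψ = ψ) (hZ : ∀ j, gZ j ψ = ψ)
    (E : H7 →ₗ[ℂ] H7) (hE : E = xo u * zo w) : T (E ψ) = ψ := by
  have h : E ψ = xo u (zo w ψ) := by rw [hE]; rfl
  rw [h]; exact T_corr u w ψ hX hZ

lemma r_mem (j : Fin 3) : r j ∈ Hcode := by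
  apply Submodule.subset_span
  fin_cases j <;> simp

lemma add_r_mem (j : Fin 3) (v : V7) : v + r j ∈ Hcode ↔ v ∈ Hcode :=
  Submodule.add_mem_iff_left _ (r_mem j)

lemma r_par (j k : Fin 3) : ∑ i ∈ S j, r k i = 0 := by revert j k; decide

lemma one_par (j : Fin 3) : ∑ i ∈ S j, (1 : V7) i = 0 := by revert j; decide

lemma mem_par (j : Fin 3) (v : V7) (hv : v ∈ Hcode) : ∑ i ∈ S j, v i = 0 := by
  induction hv using Submodule.span_induction with
  | mem x hx =>
    rcases hx with rfl | rfl | rfl <;> exact r_par j _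
  | zero => simp
  | add x y _ _ hx hy => simp [Finset.sum_add_distrib, hx, hy]
  | smul a x _ hx => simp [← Finset.mul_sum, hx]

open Classical in
lemma u0_apply (v : V7) : u0 v = ((Real.sqrt 8 : ℂ))⁻¹ * (if v ∈ Hcode then 1 else 0) := by
  rw [u0, Pi.smul_apply, smul_eq_mul, finsum_mem_eq_toFinset_sum, Finset.sum_apply]
  simp [e, Pi.single_apply]

open Classical in
lemma u1_apply (v : V7) : u1 v = ((Real.sqrt 8 : ℂ))⁻¹ * (if v + 1 ∈ Hcode then 1 else 0) := by
  rw [u1, Pi.smul_apply, smul_eq_mul, finsum_mem_eq_toFinset_sum, Finset.sum_apply]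
  have : ∀ x : V7, v = x + 1 ↔ v + 1 = x := by
    intro x
    constructor
    · rintro rfl; rw [add_assoc, dbl, add_zero]
    · rintro rfl; rw [add_assoc, dbl, add_zero]
  simp [e, Pi.single_apply, this]

lemma code_stab (ψ : H7) (hψ : ψ ∈ Cspace) : (∀ j, gX j ψ = ψ) ∧ (∀ j, gZ j ψ = ψ) := by
  induction hψ using Submodule.span_induction with
  | mem x hx =>
    rcases hx with rfl | rfl
    · refine ⟨fun j => ?_, fun j => ?_⟩ <;> funext v
      · rw [gX_apply, u0_apply, u0_apply, add_r_mem]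
      · rw [gZ_apply, u0_apply]
        split_ifs with h
        · rw [mem_par j v h]; simp
        · simp
    · refine ⟨fun j => ?_, fun j => ?_⟩ <;> funext v
      · rw [gX_apply, u1_apply, u1_apply, add_right_comm, add_r_mem]
      · rw [gZ_apply, u1_apply]
        split_ifs with h
        · have := mem_par j _ h
          simp only [Pi.add_apply, Finset.sum_add_distrib, one_par, add_zero] at this
          rw [this]; simp
        · simp
  | zero => simp
  | add x y _ _ hx hy => simp [hx, hy]
  | smul a x _ hx => simp [hx]

/-- The Steane recovery operator corrects any error consisting of at most one
bit-flip and at most one phase-flip. -/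
theorem steane_recovery_corrects (E : H7 →ₗ[ℂ] H7) (hE : E ∈ errSet)
    (ψ : H7) (hψ : ψ ∈ Cspace) : T (E ψ) = ψ := by
  obtain ⟨hX, hZ⟩ := code_stab ψ hψ
  rcases hE with ((h | ⟨i, rfl⟩) | ⟨k, rfl⟩) | ⟨i, k, rfl⟩
  · rw [Set.mem_singleton_iff] at h
    exact T_corr2 0 0 ψ hX hZ E (by rw [h, xo_zero, zo_zero, mul_one])
  · exact T_corr2 (σs i) 0 ψ hX hZ _ (by rw [xo_sigma, zo_zero, mul_one])
  · exact T_corr2 0 (σs k) ψ hX hZ _ (by rw [xo_zero, zo_sigma, one_mul])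
  · exact T_corr2 (σs i) (σs k) ψ hX hZ _ (by rw [xo_sigma, zo_sigma])

end
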